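/- For n = 2ν or 2ν+1 and μ ≥ ν, the Pfaffian Pf of the 2μ×2μ skew-symmetric matrix with entries B⁽ⁱʲ⁾ (polarized scalar products of 2μ generic vectors in n-space) is divisible by 2^{μ−ν} in the polynomial ring over ℤ. -/

import Mathlib

open MvPolynomial

/-- Permutations giving a canonical perfect matching: σ(2i) < σ(2i+1) and σ(2i) increasing. -/
def pfPerms (μ : ℕ) : Finset (Equiv.Perm (Fin (2*μ))) :=
  Finset.univ.filter fun σ =>
    (∀ i : Fin μ, σ ⟨2*i.1, by have := i.2; omega⟩ < σ ⟨2*i.1+1, by have := i.2; omega⟩) ∧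
    (∀ i j : Fin μ, i < j →
      σ ⟨2*i.1, by have := i.2; omega⟩ < σ ⟨2*j.1, by have := j.2; omega⟩)


/-- The Pfaffian of a `2μ × 2μ` matrix (intended for skew-symmetric matrices). -/
def pfaffian {R : Type*} [CommRing R] {μ : ℕ} (A : Matrix (Fin (2*μ)) (Fin (2*μ)) R) : R :=
  ∑ σ ∈ pfPerms μ, (Equiv.Perm.sign σ : ℤ) •
    ∏ i : Fin μ, A (σ ⟨2*i.1, by have := i.2; omega⟩) (σ ⟨2*i.1+1, by have := i.2; omega⟩)


/-- The polarized scalar product `B⁽ⁱʲ⁾` of the generic vectors `v⁽ⁱ⁾` and `v⁽ʲ⁾`. -/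
noncomputable def Bpoly (n m : ℕ) (i j : Fin m) : MvPolynomial (Fin m × Fin n) ℤ :=
  (∑ r : Fin (n/2),
      (X (i, ⟨2*r.1, by have := r.2; omega⟩) * X (j, ⟨2*r.1+1, by have := r.2; omega⟩)
       + X (i, ⟨2*r.1+1, by have := r.2; omega⟩) * X (j, ⟨2*r.1, by have := r.2; omega⟩)))
  + if h : n % 2 = 1 then 2 * X (i, ⟨n-1, by omega⟩) * X (j, ⟨n-1, by omega⟩) else 0


/-- The `2μ × 2μ` skew-symmetric matrix of the `B⁽ⁱʲ⁾`. -/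
noncomputable def Bmat (n μ : ℕ) :
    Matrix (Fin (2*μ)) (Fin (2*μ)) (MvPolynomial (Fin (2*μ) × Fin n) ℤ) :=
  fun i j => if i < j then Bpoly n (2*μ) i j else if j < i then -(Bpoly n (2*μ) j i) else 0

/-- Grouping a sum according to the sorting permutation of an injective key. -/
lemma sum_eq_factorial_smul {X R : Type*} [Fintype X] [CommRing R] {μ N : ℕ}
    (key : X → Fin μ → Fin N) (act : Equiv.Perm (Fin μ) → X ≃ X)
    (hkey : ∀ τ x, key (act τ x) = key x ∘ τ) (G : X → R)
    (hG : ∀ τ x, G (act τ x) = G x) (h0 : ∀ x, ¬ Function.Injective (key x) → G x = 0) :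
    ∑ x, G x = (μ.factorial : R) * ∑ x, (open Classical in if StrictMono (key x) then G x else 0) := by
  classical
  have h1 : ∀ x, G x = ∑ τ : Equiv.Perm (Fin μ), if StrictMono (key x ∘ τ) then G x else 0 := by
    intro x
    by_cases hx : Function.Injective (key x)
    · have hs : StrictMono (key x ∘ Tuple.sort (key x)) :=
        (Tuple.monotone_sort (key x)).strictMono_of_injective (hx.comp (Equiv.injective _))
      rw [Finset.sum_eq_single (Tuple.sort (key x))]
      · rw [if_pos hs]
      · intro τ _ hne
        rw [if_neg]
        intro hm
        apply hne
        have := Tuple.unique_monotone hm.monotone hs.monotone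
        ext i
        have h2 := hx (congrFun this i)
        rw [h2]
      · simp
    · simp [h0 x hx]
  rw [Finset.sum_congr rfl (fun x _ => h1 x), Finset.sum_comm]
  have h2 : ∀ τ : Equiv.Perm (Fin μ), (∑ x, if StrictMono (key x ∘ τ) then G x else 0)
      = ∑ x, if StrictMono (key x) then G x else 0 := by
    intro τ
    rw [← Equiv.sum_comp (act τ) (fun x => if StrictMono (key x) then G x else 0)]
    simp only [hkey, hG]
  simp only [h2]
  simp [Fintype.card_perm]

/-- The pairing of positions. -/
def pairEquiv (μ : ℕ) : Fin μ × Fin 2 ≃ Fin (2*μ) :=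
  finProdFinEquiv.trans (finCongr (Nat.mul_comm μ 2))

lemma pairEquiv_zero (μ : ℕ) (i : Fin μ) (h : 2 * i.1 < 2 * μ) :
    (⟨2*i.1, h⟩ : Fin (2*μ)) = pairEquiv μ (i, 0) := by
  ext; simp [pairEquiv]

lemma pairEquiv_one (μ : ℕ) (i : Fin μ) (h : 2 * i.1 + 1 < 2 * μ) :
    (⟨2*i.1+1, h⟩ : Fin (2*μ)) = pairEquiv μ (i, 1) := by
  ext; simp [pairEquiv]; omega

/-- Sum over all permutations. -/
def altSum {R : Type*} [CommRing R] {μ : ℕ} (U : Fin μ → Fin (2*μ) → Fin (2*μ) → R) : R :=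
  ∑ σ : Equiv.Perm (Fin (2*μ)), ((Equiv.Perm.sign σ : ℤ) : R) *
    ∏ i : Fin μ, U i (σ (pairEquiv μ (i, 0))) (σ (pairEquiv μ (i, 1)))

/-- Block permutation. -/
def blk {μ : ℕ} (τ : Equiv.Perm (Fin μ)) : Equiv.Perm (Fin (2*μ)) :=
  (pairEquiv μ).permCongr (Equiv.prodCongrLeft (fun _ : Fin 2 => τ))

lemma blk_apply {μ : ℕ} (τ : Equiv.Perm (Fin μ)) (i : Fin μ) (b : Fin 2) :
    blk τ (pairEquiv μ (i, b)) = pairEquiv μ (τ i, b) := by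
  simp [blk, Equiv.permCongr_apply]

lemma sign_blk {μ : ℕ} (τ : Equiv.Perm (Fin μ)) : Equiv.Perm.sign (blk τ) = 1 := by
  rw [blk, Equiv.Perm.sign_permCongr, Equiv.Perm.sign_prodCongrLeft]
  simp

/-- Flips inside blocks. -/
def flp {μ : ℕ} (p : Fin μ → Equiv.Perm (Fin 2)) : Equiv.Perm (Fin (2*μ)) :=
  (pairEquiv μ).permCongr (Equiv.prodCongrRight p)

lemma flp_apply {μ : ℕ} (p : Fin μ → Equiv.Perm (Fin 2)) (i : Fin μ) (b : Fin 2) :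
    flp p (pairEquiv μ (i, b)) = pairEquiv μ (i, p i b) := by
  simp [flp, Equiv.permCongr_apply]

lemma sign_flp {μ : ℕ} (p : Fin μ → Equiv.Perm (Fin 2)) :
    Equiv.Perm.sign (flp p) = ∏ i, Equiv.Perm.sign (p i) := by
  rw [flp, Equiv.Perm.sign_permCongr, Equiv.Perm.sign_prodCongrRight]

lemma altSum_comp {R : Type*} [CommRing R] {μ : ℕ} (U : Fin μ → Fin (2*μ) → Fin (2*μ) → R)
    (τ : Equiv.Perm (Fin μ)) : altSum (U ∘ τ) = altSum U := by
  unfold altSum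
  rw [← Equiv.sum_comp (Equiv.mulRight (blk τ))]
  refine Finset.sum_congr rfl fun σ _ => ?_
  simp only [Equiv.coe_mulRight, Equiv.Perm.sign_mul, sign_blk, mul_one, Equiv.Perm.mul_apply,
    blk_apply, Function.comp]
  rw [Equiv.prod_comp τ (fun i => U i (σ (pairEquiv μ (i, 0))) (σ (pairEquiv μ (i, 1))))]

lemma altSum_antisymm {R : Type*} [CommRing R] {μ : ℕ} (U : Fin μ → Fin (2*μ) → Fin (2*μ) → R) :
    altSum (fun i a b => U i a b - U i b a) = 2 ^ μ * altSum U := by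
  have key : ∀ p : Fin μ → Equiv.Perm (Fin 2),
      ∑ σ : Equiv.Perm (Fin (2*μ)), ((Equiv.Perm.sign σ : ℤ) : R) *
        ∏ i : Fin μ, (((Equiv.Perm.sign (p i) : ℤ) : R) *
          U i (σ (pairEquiv μ (i, p i 0))) (σ (pairEquiv μ (i, p i 1)))) = altSum U := by
    intro p
    unfold altSum
    rw [← Equiv.sum_comp (Equiv.mulRight (flp p)) (fun σ => ((Equiv.Perm.sign σ : ℤ) : R) *
      ∏ i : Fin μ, U i (σ (pairEquiv μ (i, 0))) (σ (pairEquiv μ (i, 1))))]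
    refine Finset.sum_congr rfl fun σ _ => ?_
    simp only [Equiv.coe_mulRight, Equiv.Perm.sign_mul, sign_flp, Equiv.Perm.mul_apply,
      flp_apply, Finset.prod_mul_distrib]
    push_cast
    ring
  have h2 : ∀ (i : Fin μ) (σ : Equiv.Perm (Fin (2*μ))),
      U i (σ (pairEquiv μ (i, 0))) (σ (pairEquiv μ (i, 1))) -
        U i (σ (pairEquiv μ (i, 1))) (σ (pairEquiv μ (i, 0))) =
      ∑ q : Equiv.Perm (Fin 2), (((Equiv.Perm.sign q : ℤ) : R) *
          U i (σ (pairEquiv μ (i, q 0))) (σ (pairEquiv μ (i, q 1)))) := by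
    intro i σ
    have hu : (Finset.univ : Finset (Equiv.Perm (Fin 2))) = {1, Equiv.swap 0 1} := by decide
    rw [hu, Finset.sum_pair (by decide)]
    simp [Equiv.Perm.sign_swap, sub_eq_add_neg]
  have h3 : altSum (fun i a b => U i a b - U i b a) = ∑ p : Fin μ → Equiv.Perm (Fin 2), altSum U := by
    rw [← Finset.sum_congr rfl (fun p _ => key p), Finset.sum_comm]
    unfold altSum
    refine Finset.sum_congr rfl fun σ _ => ?_
    rw [← Finset.mul_sum]
    simp only [h2]
    rw [Finset.prod_univ_sum, Fintype.piFinset_univ]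
  rw [h3]
  simp [Fintype.card_perm]

lemma altSum_rank_one {R : Type*} [CommRing R] {μ : ℕ} (c : Fin μ → R)
    (u w : Fin μ → Fin (2*μ) → R) {i j : Fin μ} (hij : i ≠ j) (hu : u i = u j) :
    altSum (fun i a b => c i * (u i a * w i b)) = 0 := by
  have h : altSum (fun i a b => c i * (u i a * w i b)) = (∏ i, c i) *
      Matrix.det (Matrix.of fun a k : Fin (2*μ) =>
        if ((pairEquiv μ).symm k).2 = 0 then u ((pairEquiv μ).symm k).1 a
        else w ((pairEquiv μ).symm k).1 a) := by
    rw [Matrix.det_apply', altSum, Finset.mul_sum]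
    refine Finset.sum_congr rfl fun σ _ => ?_
    rw [← Equiv.prod_comp (pairEquiv μ), Fintype.prod_prod_type]
    simp only [Fin.prod_univ_two, Matrix.of_apply, Equiv.symm_apply_apply, if_true,
      Finset.prod_mul_distrib]
    simp
    ring
  rw [h, Matrix.det_zero_of_column_eq (i := pairEquiv μ (i, 0)) (j := pairEquiv μ (j, 0)), mul_zero]
  · simpa using hij
  · intro k
    simp [hu]

lemma altSum_expand {R T : Type*} [CommRing R] [Fintype T] [DecidableEq T] {μ : ℕ}
    (c : T → R) (u w : T → Fin (2*μ) → R) :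
    altSum (fun (_ : Fin μ) a b => ∑ t, c t * (u t a * w t b)) =
      ∑ f : Fin μ → T, altSum (fun i a b => c (f i) * (u (f i) a * w (f i) b)) := by
  unfold altSum
  rw [Finset.sum_comm]
  refine Finset.sum_congr rfl fun σ _ => ?_
  rw [← Finset.mul_sum, Finset.prod_univ_sum, Fintype.piFinset_univ]

lemma altSum_dvd {R : Type*} [CommRing R] {μ : ℕ} (d : R) (c : Fin μ → R)
    (u w : Fin μ → Fin (2*μ) → R) (hd : d ∣ ∏ i, c i) :
    d ∣ altSum (fun i a b => c i * (u i a * w i b)) := by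
  unfold altSum
  refine Finset.dvd_sum fun σ _ => ?_
  rw [Finset.prod_mul_distrib]
  exact Dvd.dvd.mul_left (Dvd.dvd.mul_right hd _) _

lemma two_pow_dvd_prod {R P : Type*} [CommRing R] {μ ν : ℕ} (D : P → R) (f : Fin μ → Fin ν ⊕ P)
    (hf : Function.Injective f) :
    (2 : R) ^ (μ - ν) ∣ ∏ i, Sum.elim (fun _ => (1 : R)) (fun p => 2 * D p) (f i) := by
  classical
  have hc : (Finset.univ.filter fun i => (f i).isLeft = true).card ≤ ν := by
    have := Finset.card_le_card_of_injOn (s := Finset.univ.filter fun i => (f i).isLeft = true)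
      (t := (Finset.univ : Finset (Fin ν)).image (fun r => (Sum.inl r : Fin ν ⊕ P))) f
      (by
        intro i hi
        simp only [Finset.coe_filter, Finset.mem_univ, true_and, Set.mem_setOf_eq] at hi
        obtain ⟨r, hr⟩ := Sum.isLeft_iff.1 hi
        simp [hr]) hf.injOn
    refine this.trans (Finset.card_image_le.trans (by simp))
  have hs := Finset.card_filter_add_card_filter_not (s := (Finset.univ : Finset (Fin μ)))
    (fun i => (f i).isLeft = true)
  rw [Finset.card_univ, Fintype.card_fin] at hs
  rw [← Finset.prod_filter_mul_prod_filter_not Finset.univ (fun i => (f i).isLeft = true)]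
  apply Dvd.dvd.mul_left
  refine (pow_dvd_pow (2 : R) (show μ - ν ≤
    (Finset.univ.filter fun i => ¬ (f i).isLeft = true).card by omega)).trans ?_
  rw [← Finset.prod_const]
  refine Finset.prod_dvd_prod_of_dvd _ _ fun i hi => ?_
  simp only [Finset.mem_filter, Finset.mem_univ, true_and] at hi
  rcases h : f i with r | p
  · simp [h] at hi
  · simp

lemma altSum_main {R : Type*} [CommRing R] {μ ν : ℕ} (x y : Fin ν → Fin (2*μ) → R)
    (D : Fin (2*μ) × Fin (2*μ) → R) :
    ∃ q, altSum (fun (_ : Fin μ) a b => (∑ r, x r a * y r b) + 2 * D (a, b)) =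
      (μ.factorial : R) * (2 ^ (μ - ν) * q) := by
  classical
  let T := Fin ν ⊕ (Fin (2*μ) × Fin (2*μ))
  let c : T → R := Sum.elim (fun _ => (1 : R)) (fun p => 2 * D p)
  let u : T → Fin (2*μ) → R := Sum.elim x (fun p => Pi.single p.1 1)
  let w : T → Fin (2*μ) → R := Sum.elim y (fun p => Pi.single p.2 1)
  have h1 : (fun (_ : Fin μ) a b => (∑ r, x r a * y r b) + 2 * D (a, b)) =
      (fun (_ : Fin μ) a b => ∑ t, c t * (u t a * w t b)) := by
    funext _ a b
    rw [Fintype.sum_sum_type, Fintype.sum_prod_type]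
    simp [c, u, w, Pi.single_apply]
  rw [h1, altSum_expand]
  rw [sum_eq_factorial_smul (N := Fintype.card T)
    (fun (f : Fin μ → T) i => Fintype.equivFin T (f i))
    (fun τ => Equiv.arrowCongr τ.symm (Equiv.refl T))]
  · have : (2 : R) ^ (μ - ν) ∣ ∑ f : Fin μ → T,
        if StrictMono (fun i => Fintype.equivFin T (f i)) then
          altSum (fun i a b => c (f i) * (u (f i) a * w (f i) b)) else 0 := by
      refine Finset.dvd_sum fun f _ => ?_
      split_ifs with hf
      · refine altSum_dvd _ (fun i => c (f i)) (fun i => u (f i)) (fun i => w (f i)) ?_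
        exact two_pow_dvd_prod D f (fun i j hij => hf.injective (by simp [hij]))
      · exact dvd_zero _
    obtain ⟨q, hq⟩ := this
    exact ⟨q, by rw [← hq]⟩
  · intro τ f
    funext i
    simp [Equiv.arrowCongr]
  · intro τ f
    exact altSum_comp (fun i a b => c (f i) * (u (f i) a * w (f i) b)) τ
  · intro f hf
    have : ¬ Function.Injective f := fun h => hf ((Fintype.equivFin T).injective.comp h)
    simp only [Function.Injective, not_forall] at this
    obtain ⟨i, j, hij, hne⟩ := this
    exact altSum_rank_one (fun i => c (f i)) (fun i => u (f i)) (fun i => w (f i)) hne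
      (by simp [hij])

lemma altSum_pfaffian {R : Type*} [CommRing R] {μ : ℕ} (A : Matrix (Fin (2*μ)) (Fin (2*μ)) R) :
    altSum (fun (_ : Fin μ) a b => if a < b then A a b else 0) =
      (μ.factorial : R) * pfaffian A := by
  classical
  rw [altSum, sum_eq_factorial_smul (N := 2*μ)
    (fun (σ : Equiv.Perm (Fin (2*μ))) i => σ (pairEquiv μ (i, 0)))
    (fun τ => Equiv.mulRight (blk τ))]
  · congr 1
    rw [pfaffian, pfPerms, Finset.sum_filter]
    refine Finset.sum_congr rfl fun σ _ => ?_
    simp only [pairEquiv_zero, pairEquiv_one]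
    by_cases h2 : StrictMono fun i => σ (pairEquiv μ (i, 0))
    · rw [if_pos h2]
      by_cases h1 : ∀ i : Fin μ, σ (pairEquiv μ (i, 0)) < σ (pairEquiv μ (i, 1))
      · rw [if_pos ⟨h1, fun i j hij => h2 hij⟩]
        simp [h1, zsmul_eq_mul]
      · rw [if_neg (fun h => h1 h.1)]
        push Not at h1
        obtain ⟨i, hi⟩ := h1
        rw [Finset.prod_eq_zero (Finset.mem_univ i) (if_neg (not_lt.2 hi)), mul_zero]
    · rw [if_neg h2, if_neg (fun h => h2 (fun i j hij => h.2 i j hij))]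
  · intro τ σ
    funext i
    simp [blk_apply]
  · intro τ σ
    simp only [Equiv.coe_mulRight, Equiv.Perm.sign_mul, sign_blk, mul_one, Equiv.Perm.mul_apply,
      blk_apply]
    rw [Equiv.prod_comp τ (fun i => if σ (pairEquiv μ (i, 0)) < σ (pairEquiv μ (i, 1)) then
      A (σ (pairEquiv μ (i, 0))) (σ (pairEquiv μ (i, 1))) else 0)]
  · intro σ hσ
    refine absurd (fun i j hij => ?_) hσ
    simpa using hij

/-- For `n = 2ν` or `2ν + 1` and `μ ≥ ν`, the Pfaffian of the `2μ × 2μ` skew-symmetric matrix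
of the polarized scalar products `B⁽ⁱʲ⁾` of `2μ` generic vectors in `n`-space is divisible by
`2^(μ−ν)` in the polynomial ring over `ℤ`. -/
theorem two_pow_dvd_pfaffian_Bmat (n μ : ℕ) (hμ : n / 2 ≤ μ) :
    (2 ^ (μ - n / 2) : MvPolynomial (Fin (2*μ) × Fin n) ℤ) ∣ pfaffian (Bmat n μ) := by
  classical
  let R := MvPolynomial (Fin (2*μ) × Fin n) ℤ
  let x : Fin (n/2) → Fin (2*μ) → R := fun r i => X (i, ⟨2*r.1, by have := r.2; omega⟩)
  let y : Fin (n/2) → Fin (2*μ) → R := fun r i => X (i, ⟨2*r.1+1, by have := r.2; omega⟩)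
  let Z : Fin (2*μ) → Fin (2*μ) → R := fun i j =>
    if h : n % 2 = 1 then X (i, ⟨n-1, by omega⟩) * X (j, ⟨n-1, by omega⟩) else 0
  have hB : ∀ i j, Bpoly n (2*μ) i j = (∑ r, x r i * y r j) + (∑ r, y r i * x r j) + 2 * Z i j := by
    intro i j
    simp only [Bpoly, x, y, Z, Finset.sum_add_distrib]
    split_ifs <;> ring
  have hsw : ∀ i j, (∑ r, y r i * x r j) = ∑ r, x r j * y r i := fun i j =>
    Finset.sum_congr rfl fun r _ => mul_comm _ _
  let D : Fin (2*μ) × Fin (2*μ) → R := fun p =>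
    if p.1 < p.2 then (∑ r, y r p.1 * x r p.2) + Z p.1 p.2 else 0
  have h1 := altSum_pfaffian (Bmat n μ)
  obtain ⟨q, hq⟩ := altSum_main x y D
  have h2 := altSum_antisymm (fun (_ : Fin μ) a b => if a < b then Bmat n μ a b else 0)
  have h3 := altSum_antisymm (fun (_ : Fin μ) a b => (∑ r, x r a * y r b) + 2 * D (a, b))
  have h4 : (fun (_ : Fin μ) a b => (if a < b then Bmat n μ a b else 0) -
      (if b < a then Bmat n μ b a else 0)) =
      (fun (_ : Fin μ) a b => ((∑ r, x r a * y r b) + 2 * D (a, b)) -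
        ((∑ r, x r b * y r a) + 2 * D (b, a))) := by
    funext _ a b
    rcases lt_trichotomy a b with h | h | h
    · simp only [Bmat, D, if_pos h, if_neg h.asymm, hB, hsw]
      ring
    · subst h
      simp
    · simp only [Bmat, D, if_pos h, if_neg h.asymm, hB, hsw]
      ring
  rw [h4, h3, hq, h1] at h2
  have hne : (2 : R) ^ μ ≠ 0 := pow_ne_zero _ two_ne_zero
  have hne2 : ((μ.factorial : ℕ) : R) ≠ 0 := Nat.cast_ne_zero.2 (Nat.factorial_ne_zero μ)
  exact ⟨q, (mul_left_cancel₀ hne2 (mul_left_cancel₀ hne h2)).symm⟩
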